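/- Let p be an odd prime, n ≥ 1 an integer, and let c be a nonempty list of integers with every entry ≥ 2 such that s(c) = pⁿ. Then the following are equivalent: (i) 𝓢(c) is palindromic; (ii) r(c) ≡ 1 (mod pⁿ) or r(c) ≡ −1 (mod pⁿ); (iii) 𝓢(c) = [pⁿ]_q = 1 + q + ⋯ + q^{pⁿ−1}. -/

import Mathlib

open Polynomial

/-- The `q`-deformation `[n]_q = 1 + q + ⋯ + q^{n-1}` of a nonnegative integer. -/
noncomputable def qNat (n : ℕ) : Polynomial ℤ := (Finset.range n).sum fun i => X ^ i

/-- The matrix `M_q⁻(c) = (([c]_q, -q^{c-1}), (1, 0))` over `ℤ[q]`. -/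
noncomputable def MqNeg (c : ℕ) : Matrix (Fin 2) (Fin 2) (Polynomial ℤ) :=
  !![qNat c, -(X ^ (c - 1)); 1, 0]

/-- `𝓡(c)`: the (0,0) entry of `M_q⁻(c₁)⋯M_q⁻(c_l)`. -/
noncomputable def Rpoly (L : List ℕ) : Polynomial ℤ := ((L.map MqNeg).prod) 0 0

/-- `𝓢(c)`: the (1,0) entry of `M_q⁻(c₁)⋯M_q⁻(c_l)`. -/
noncomputable def Spoly (L : List ℕ) : Polynomial ℤ := ((L.map MqNeg).prod) 1 0

/-- `r(c) = 𝓡(c)(1)`. -/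
noncomputable def rNum (L : List ℕ) : ℤ := (Rpoly L).eval 1

/-- `s(c) = 𝓢(c)(1)`. -/
noncomputable def sNum (L : List ℕ) : ℤ := (Spoly L).eval 1

/-! ### The polynomials `[n]_q` -/

theorem qNat_zero : qNat 0 = 0 := by simp [qNat]

theorem qNat_succ (n : ℕ) : qNat (n + 1) = qNat n + X ^ n := by
  simp [qNat, Finset.sum_range_succ]

theorem coeff_qNat (n i : ℕ) : (qNat n).coeff i = if i < n then 1 else 0 := by
  simp [qNat, coeff_X_pow]

theorem eval_one_qNat (n : ℕ) : (qNat n).eval 1 = n := by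
  simp [qNat, eval_finsetSum]

theorem two_mul_eval_one_derivative_qNat (n : ℕ) :
    2 * (derivative (qNat n)).eval 1 = (n : ℤ) * (n - 1) := by
  induction n with
  | zero => simp [qNat_zero]
  | succ n ih =>
    rw [qNat_succ, derivative_add, eval_add, mul_add, ih]
    simp [derivative_X_pow]
    ring

theorem natDegree_qNat_succ (n : ℕ) : (qNat (n + 1)).natDegree = n := by
  apply natDegree_eq_of_le_of_coeff_ne_zero
  · rw [natDegree_le_iff_coeff_eq_zero]
    intro i hi
    rw [coeff_qNat, if_neg (by omega)]
  · simp [coeff_qNat]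

theorem reverse_qNat (n : ℕ) : (qNat n).reverse = qNat n := by
  cases n with
  | zero => simp [qNat_zero]
  | succ n =>
    ext i
    rw [coeff_reverse, natDegree_qNat_succ]
    rcases le_or_gt i n with h | h
    · rw [revAt_le h, coeff_qNat, coeff_qNat, if_pos (by omega), if_pos (by omega)]
    · rw [revAt_eq_self_of_lt h]

/-- A palindromic polynomial of degree `d` satisfies `2 f'(1) = d f(1)`. -/
theorem two_mul_eval_one_derivative_of_reverse_eq_self {f : Polynomial ℤ}
    (hf : f.reverse = f) :
    2 * (derivative f).eval 1 = f.natDegree * f.eval 1 := by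
  have hd : (derivative f).eval 1 =
      ∑ i ∈ Finset.range (f.natDegree + 1), f.coeff i * (i : ℤ) := by
    rw [derivative_eval, sum_over_range _ (by simp)]
    simp
  have hd' : (derivative f).eval 1 =
      ∑ i ∈ Finset.range (f.natDegree + 1), f.coeff i * ((f.natDegree : ℤ) - i) := by
    rw [hd, ← Finset.sum_range_reflect]
    refine Finset.sum_congr rfl fun i hi => ?_
    have hi' : i ≤ f.natDegree := by simpa [Nat.lt_succ_iff] using hi
    have hc : f.coeff (f.natDegree - i) = f.coeff i := by
      conv_rhs => rw [← hf, coeff_reverse, revAt_le hi']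
    rw [show f.natDegree + 1 - 1 - i = f.natDegree - i by omega, hc, Nat.cast_sub hi']
  rw [two_mul]
  nth_rewrite 1 [hd]
  rw [hd', ← Finset.sum_add_distrib, eval_eq_sum_range, Finset.mul_sum]
  refine Finset.sum_congr rfl fun i _ => ?_
  simp
  ring

/-! ### Recursions along the continued fraction -/

@[simp] theorem Rpoly_nil : Rpoly [] = 1 := by simp [Rpoly]

@[simp] theorem Spoly_nil : Spoly [] = 0 := by simp [Spoly]

theorem Rpoly_cons (c : ℕ) (L : List ℕ) :
    Rpoly (c :: L) = qNat c * Rpoly L - X ^ (c - 1) * Spoly L := by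
  simp [Rpoly, Spoly, MqNeg, Matrix.mul_apply, Fin.sum_univ_two]
  ring

theorem Spoly_cons (c : ℕ) (L : List ℕ) : Spoly (c :: L) = Rpoly L := by
  simp [Rpoly, Spoly, MqNeg, Matrix.mul_apply, Fin.sum_univ_two]

theorem rNum_nil : rNum [] = 1 := by simp [rNum]

theorem sNum_nil : sNum [] = 0 := by simp [sNum]

theorem rNum_cons (c : ℕ) (L : List ℕ) : rNum (c :: L) = c * rNum L - sNum L := by
  simp [rNum, sNum, Rpoly_cons, eval_one_qNat]

theorem sNum_cons (c : ℕ) (L : List ℕ) : sNum (c :: L) = rNum L := by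
  simp [rNum, sNum, Spoly_cons]

/-- The derivatives at `q = 1` of `𝓡` and `𝓢` in terms of the entries of the matrix product
at `q = 1`; here `u` and `v` are the negatives of the entries of its second column. -/
theorem exists_two_mul_eval_one_derivative (L : List ℕ) (hL : ∀ y ∈ L, 1 ≤ y) :
    ∃ u v k : ℤ, u * sNum L - rNum L * v = 1 ∧
      2 * (derivative (Rpoly L)).eval 1 = k * rNum L + sNum L - u ∧
      2 * (derivative (Spoly L)).eval 1 = (k + 1) * sNum L - v - rNum L := by
  induction L with
  | nil => exact ⟨0, -1, 0, by simp [rNum_nil, sNum_nil]⟩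
  | cons c L ih =>
    obtain ⟨u, v, k, hdet, hR, hS⟩ := ih fun y hy => hL y (List.mem_cons_of_mem c hy)
    have hc : 1 ≤ c := hL c List.mem_cons_self
    have hq := two_mul_eval_one_derivative_qNat c
    refine ⟨c * u - v, u, k + c - 1, ?_, ?_, ?_⟩
    · rw [rNum_cons, sNum_cons]
      linear_combination hdet
    · have hD : (derivative (Rpoly (c :: L))).eval 1 =
          (derivative (qNat c)).eval 1 * rNum L + c * (derivative (Rpoly L)).eval 1
            - ((c : ℤ) - 1) * sNum L - (derivative (Spoly L)).eval 1 := by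
        simp [Rpoly_cons, eval_one_qNat, rNum, sNum, derivative_X_pow, Nat.cast_sub hc]
        ring
      rw [hD, rNum_cons, sNum_cons]
      linear_combination rNum L * hq + c * hR - hS
    · rw [Spoly_cons, rNum_cons, sNum_cons]
      linear_combination hR

/-- If `𝓢` is palindromic then `r² ≡ 1 (mod s)`. -/
theorem sNum_dvd_of_reverse_Spoly_eq_self {L : List ℕ} (hL : ∀ y ∈ L, 1 ≤ y)
    (h : (Spoly L).reverse = Spoly L) : sNum L ∣ (rNum L - 1) * (rNum L + 1) := by
  obtain ⟨u, v, k, hdet, -, hS⟩ := exists_two_mul_eval_one_derivative L hL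
  rw [two_mul_eval_one_derivative_of_reverse_eq_self h] at hS
  refine ⟨rNum L * (k + 1 - (Spoly L).natDegree) - u, ?_⟩
  have hS' : ((Spoly L).natDegree : ℤ) * sNum L = (k + 1) * sNum L - v - rNum L := hS
  linear_combination hdet + rNum L * hS'

theorem sNum_nonneg_and_lt_rNum {L : List ℕ} (hL : ∀ y ∈ L, 2 ≤ y) :
    0 ≤ sNum L ∧ sNum L < rNum L := by
  induction L with
  | nil => simp [rNum_nil, sNum_nil]
  | cons c L ih =>
    obtain ⟨h0, h1⟩ := ih fun y hy => hL y (List.mem_cons_of_mem c hy)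
    have hc : (2 : ℤ) ≤ c := by exact_mod_cast hL c List.mem_cons_self
    rw [rNum_cons, sNum_cons]
    constructor <;> nlinarith

/-- If `s = r - 1` then all entries are `2` and `𝓡`, `𝓢` are `q`-integers. -/
theorem Rpoly_eq_qNat_of_sNum_add_one_eq {L : List ℕ} (hL : ∀ y ∈ L, 2 ≤ y)
    (h : sNum L + 1 = rNum L) :
    Rpoly L = qNat (L.length + 1) ∧ Spoly L = qNat L.length := by
  induction L with
  | nil => simp [qNat_zero, qNat_succ]
  | cons c L ih =>
    have hL' : ∀ y ∈ L, 2 ≤ y := fun y hy => hL y (List.mem_cons_of_mem c hy)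
    obtain ⟨h0, h1⟩ := sNum_nonneg_and_lt_rNum hL'
    have hc : 2 ≤ c := hL c List.mem_cons_self
    rw [rNum_cons, sNum_cons] at h
    obtain rfl : c = 2 := by
      by_contra hne
      have : (3 : ℤ) ≤ c := by exact_mod_cast (by omega : 3 ≤ c)
      nlinarith
    obtain ⟨hR, hS⟩ := ih hL' (by push_cast at h; linarith)
    refine ⟨?_, by rw [Spoly_cons, hR, List.length_cons]⟩
    have h2 : qNat 2 = 1 + X := by simp [qNat, Finset.sum_range_succ]
    rw [Rpoly_cons, hR, hS, List.length_cons, h2, qNat_succ (L.length + 1)]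
    linear_combination X * qNat_succ L.length

theorem Rpoly_eq_qNat_of_sNum_eq_one {L : List ℕ} (hL : ∀ y ∈ L, 2 ≤ y)
    (h : sNum L = 1) : ∃ c, Rpoly L = qNat c := by
  rcases L with _ | ⟨c, _ | ⟨d, L⟩⟩
  · simp [sNum_nil] at h
  · exact ⟨c, by simp [Rpoly_cons]⟩
  · have hL' : ∀ y ∈ L, 2 ≤ y := fun y hy => hL y (by simp [hy])
    have hL'' : ∀ y ∈ d :: L, 2 ≤ y := fun y hy => hL y (List.mem_cons_of_mem c hy)
    have h1 := sNum_nonneg_and_lt_rNum hL'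
    have h2 := sNum_nonneg_and_lt_rNum hL''
    rw [sNum_cons] at h h2
    omega

/-- If `r ≡ ±1 (mod s)` then `𝓢 = [s]_q`. -/
theorem Spoly_eq_qNat_of_sNum_dvd {L : List ℕ} {N : ℕ} (hL : ∀ y ∈ L, 2 ≤ y)
    (hN : 2 ≤ N) (hs : sNum L = N) (h : (N : ℤ) ∣ rNum L - 1 ∨ (N : ℤ) ∣ rNum L + 1) :
    Spoly L = qNat N := by
  have aux : ∀ m, Spoly L = qNat m → Spoly L = qNat N := by
    intro m hm
    have : (m : ℤ) = N := by rw [← hs, sNum, hm, eval_one_qNat]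
    rw [hm, Nat.cast_injective this]
  rcases L with _ | ⟨c, L⟩
  · rw [sNum_nil] at hs
    omega
  have hL' : ∀ y ∈ L, 2 ≤ y := fun y hy => hL y (List.mem_cons_of_mem c hy)
  obtain ⟨h0, h1⟩ := sNum_nonneg_and_lt_rNum hL'
  rw [sNum_cons] at hs
  rw [Spoly_cons] at aux ⊢
  rw [rNum_cons, hs] at h
  rw [hs] at h1
  rcases h with ⟨t, ht⟩ | ⟨t, ht⟩
  · have hd : (N : ℤ) ∣ sNum L + 1 := ⟨c - t, by linear_combination -ht⟩
    have := Int.le_of_dvd (by omega) hd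
    exact aux _ (Rpoly_eq_qNat_of_sNum_add_one_eq hL' (by omega)).1
  · have hd : (N : ℤ) ∣ sNum L - 1 := ⟨c - t, by linear_combination -ht⟩
    have : sNum L - 1 = 0 := by
      rcases h0.eq_or_lt with h0 | h0
      · rw [← h0] at hd
        have := Int.le_of_dvd (by norm_num) ((dvd_neg (a := (N : ℤ))).2 hd)
        omega
      · exact Int.eq_zero_of_dvd_of_nonneg_of_lt (by omega) (by omega) hd
    obtain ⟨m, hm⟩ := Rpoly_eq_qNat_of_sNum_eq_one hL' (by omega)
    exact aux m hm

/-- Modulo an odd prime power, the only square roots of `1` are `±1`. -/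
theorem Int.prime_pow_dvd_sub_one_or_add_one {p : ℕ} (hp : p.Prime) (hodd : Odd p) {n : ℕ}
    {a : ℤ} (h : (p : ℤ) ^ n ∣ (a - 1) * (a + 1)) :
    (p : ℤ) ^ n ∣ a - 1 ∨ (p : ℤ) ^ n ∣ a + 1 := by
  have hp' : Prime (p : ℤ) := Nat.prime_iff_prime_int.1 hp
  by_cases h1 : (p : ℤ) ∣ a - 1
  · left
    refine IsCoprime.dvd_of_dvd_mul_right (IsCoprime.pow_left ?_) h
    refine (hp'.coprime_iff_not_dvd).2 fun h2 => ?_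
    have h3 : (p : ℤ) ∣ 2 := by simpa using (dvd_sub h2 h1).trans (by ring_nf; rfl)
    have h4 := (Nat.prime_dvd_prime_iff_eq hp Nat.prime_two).1 (by exact_mod_cast h3)
    rw [h4] at hodd
    exact absurd hodd (by decide)
  · right
    exact IsCoprime.dvd_of_dvd_mul_left ((hp'.coprime_iff_not_dvd).2 h1).pow_left h

/-- For an odd prime `p`, `n ≥ 1`, and an irreducible fraction `a/pⁿ` given by a list `L`:
`𝓢(L)` is palindromic iff `a ≡ ±1 (mod pⁿ)`, iff `𝓢(L) = [pⁿ]_q`. -/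
theorem stmt9 (p : ℕ) (hp : p.Prime) (hodd : Odd p) (n : ℕ) (hn : 1 ≤ n)
    (L : List ℕ) (hL : L ≠ []) (hL2 : ∀ y ∈ L, 2 ≤ y)
    (hs : sNum L = (p : ℤ) ^ n) :
    ((Spoly L).reverse = Spoly L ↔
      (rNum L ≡ 1 [ZMOD (p : ℤ) ^ n] ∨ rNum L ≡ -1 [ZMOD (p : ℤ) ^ n])) ∧
    ((Spoly L).reverse = Spoly L ↔ Spoly L = qNat (p ^ n)) := by
  have hL1 : ∀ y ∈ L, 1 ≤ y := fun y hy => one_le_two.trans (hL2 y hy)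
  have hN : 2 ≤ p ^ n := hp.two_le.trans (Nat.le_self_pow (by omega) p)
  have h1 : (rNum L ≡ 1 [ZMOD (p : ℤ) ^ n]) ↔ (p : ℤ) ^ n ∣ rNum L - 1 := by
    rw [Int.modEq_comm, Int.modEq_iff_dvd]
  have h2 : (rNum L ≡ -1 [ZMOD (p : ℤ) ^ n]) ↔ (p : ℤ) ^ n ∣ rNum L + 1 := by
    rw [Int.modEq_comm, Int.modEq_iff_dvd, sub_neg_eq_add]
  rw [h1, h2]
  have hi : (Spoly L).reverse = Spoly L →
      ((p : ℤ) ^ n ∣ rNum L - 1 ∨ (p : ℤ) ^ n ∣ rNum L + 1) := fun h =>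
    Int.prime_pow_dvd_sub_one_or_add_one hp hodd (hs ▸ sNum_dvd_of_reverse_Spoly_eq_self hL1 h)
  have hii : ((p : ℤ) ^ n ∣ rNum L - 1 ∨ (p : ℤ) ^ n ∣ rNum L + 1) →
      Spoly L = qNat (p ^ n) := fun h =>
    Spoly_eq_qNat_of_sNum_dvd hL2 hN (by exact_mod_cast hs) (by exact_mod_cast h)
  have hiii : Spoly L = qNat (p ^ n) → (Spoly L).reverse = Spoly L := fun h => by
    rw [h, reverse_qNat]
  exact ⟨⟨hi, fun h => hiii (hii h)⟩, ⟨fun h => hii (hi h), hiii⟩⟩
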